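/- Let d ≥ 3, p > (d-1)/2, and define p_* by 1/p_* = min{1/2 - 1/(2p) + 1/(d-1), 1}. Let 0 < ρ < σ, v ∈ W^{1,p_*}(B_σ) and μ ∈ L^p(B_σ) nonnegative. Then there exists c = c(d,p) such that the infimum of ∫_{B_σ} μ |v|² |∇η|² over cutoffs η ∈ C¹_c(B_σ), η ≥ 0, η = 1 on B_ρ, is at most c (σ-ρ)^{-2d/(d-1)} ‖μ‖_{L^p(B_σ∖B_ρ)} ( ‖∇v‖_{L^{p_*}(B_σ∖B_ρ)}² + ρ^{-2} ‖v‖_{L^{p_*}(B_σ∖B_ρ)}² ). -/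

import Mathlib

open MeasureTheory Metric Set
open scoped ENNReal NNReal

lemma sob_local (n : ℕ) (hn : 0 < n) (s q : ℝ) (hs : 1 ≤ s) (hq : 0 < q)
    (hqs : q⁻¹ = s⁻¹ - (n : ℝ)⁻¹) :
    ∃ C : ℝ≥0, ∀ u : (Fin n → ℝ) → ℝ, ContDiff ℝ 1 u →
      (∫⁻ y in closedBall (0 : Fin n → ℝ) 1, ‖u y‖ₑ ^ q) ^ (1 / q) ≤
        C * (∫⁻ y in closedBall (0 : Fin n → ℝ) 2, (‖u y‖ₑ ^ s + ‖fderiv ℝ u y‖ₑ ^ s)) ^ (1 / s) := by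
  have hs0 : 0 < s := by linarith
  obtain ⟨s', hs'⟩ : ∃ s' : ℝ≥0, (s' : ℝ) = s := ⟨⟨s, hs0.le⟩, rfl⟩
  obtain ⟨q', hq'⟩ : ∃ q' : ℝ≥0, (q' : ℝ) = q := ⟨⟨q, hq.le⟩, rfl⟩
  let χ : ContDiffBump (0 : Fin n → ℝ) := ⟨1, 2, by norm_num, by norm_num⟩
  have hχ : ContDiff ℝ 1 χ := χ.contDiff
  have hχc : HasCompactSupport χ := χ.hasCompactSupport
  obtain ⟨L, hL⟩ := (hχc.fderiv (𝕜 := ℝ)).exists_bound_of_continuous (hχ.continuous_fderiv one_ne_zero)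
  have hL0 : 0 ≤ L := (norm_nonneg _).trans (hL 0)
  set L1 : ℝ≥0 := L.toNNReal + 1 with hL1
  have hL1' : ∀ y, ‖fderiv ℝ χ y‖ₑ ≤ L1 := by
    intro y
    rw [enorm_eq_nnnorm]
    refine ENNReal.coe_le_coe.2 ?_
    refine le_trans ?_ (le_add_of_nonneg_right zero_le_one)
    exact NNReal.le_toNNReal_of_coe_le (hL y)
  have h1L : (1 : ℝ≥0∞) ≤ L1 := by
    rw [hL1]; push_cast; exact le_add_self
  set S := SNormLESNormFDerivOfEqConst ℝ (volume : Measure (Fin n → ℝ)) s with hS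
  refine ⟨S * (2 ^ s * L1 ^ s) ^ (1 / s), ?_⟩
  intro u hu
  set w : (Fin n → ℝ) → ℝ := fun y => χ y * u y with hw
  have hwC : ContDiff ℝ 1 w := hχ.mul hu
  have hwc : HasCompactSupport w := hχc.mul_right
  have key := eLpNorm_le_eLpNorm_fderiv_of_eq (volume : Measure (Fin n → ℝ)) hwC hwc
    (p := s') (p' := q') (by rw [← hs'] at hs; exact_mod_cast hs) (by simpa using hn)
    (by simpa [hs', hq'] using hqs)
  rw [eLpNorm_eq_lintegral_rpow_enorm_toReal (by have := hq.ne'; rw [← hq'] at this; exact_mod_cast this) (by simp),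
    eLpNorm_eq_lintegral_rpow_enorm_toReal (by have := hs0.ne'; rw [← hs'] at this; exact_mod_cast this) (by simp)] at key
  simp only [ENNReal.coe_toReal, hs', hq'] at key
  have hDw : ∀ y, ‖fderiv ℝ w y‖ₑ ^ s ≤
      (closedBall (0 : Fin n → ℝ) 2).indicator
        (fun y => (2 ^ s * L1 ^ s : ℝ≥0) * (‖u y‖ₑ ^ s + ‖fderiv ℝ u y‖ₑ ^ s)) y := by
    intro y
    by_cases hy : y ∈ closedBall (0 : Fin n → ℝ) 2
    · rw [indicator_of_mem hy]
      have h1 : fderiv ℝ w y = χ y • fderiv ℝ u y + u y • fderiv ℝ χ y :=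
        fderiv_mul (hχ.differentiable one_ne_zero y) (hu.differentiable one_ne_zero y)
      have h2 : ‖fderiv ℝ w y‖ₑ ≤ L1 * (‖u y‖ₑ + ‖fderiv ℝ u y‖ₑ) := by
        rw [h1]
        refine (enorm_add_le (χ y • fderiv ℝ u y) (u y • fderiv ℝ χ y)).trans ?_
        rw [enorm_smul, enorm_smul]
        have h3 : ‖χ y‖ₑ ≤ L1 := by
          refine le_trans ?_ h1L
          rw [Real.enorm_eq_ofReal χ.nonneg]
          exact ENNReal.ofReal_le_one.2 χ.le_one
        calc _ ≤ L1 * ‖fderiv ℝ u y‖ₑ + ‖u y‖ₑ * L1 := by gcongr; exact hL1' y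
          _ = _ := by ring
      calc ‖fderiv ℝ w y‖ₑ ^ s ≤ (L1 * (‖u y‖ₑ + ‖fderiv ℝ u y‖ₑ)) ^ s := by gcongr
        _ = L1 ^ s * (‖u y‖ₑ + ‖fderiv ℝ u y‖ₑ) ^ s := ENNReal.mul_rpow_of_nonneg _ _ hs0.le
        _ ≤ L1 ^ s * (2 ^ s * (‖u y‖ₑ ^ s + ‖fderiv ℝ u y‖ₑ ^ s)) := by
          gcongr; exact ENNReal.add_rpow_le_two_rpow_mul_rpow_add_rpow _ _ hs0.le
        _ = _ := by
          rw [ENNReal.coe_mul, ENNReal.coe_rpow_of_nonneg _ hs0.le, ENNReal.coe_rpow_of_nonneg _ hs0.le]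
          push_cast; ring
    · have : fderiv ℝ w y = 0 := by
        have hsub : tsupport w ⊆ closedBall 0 2 := by
          refine (tsupport_mul_subset_left).trans ?_
          rw [χ.tsupport_eq]
        exact image_eq_zero_of_notMem_tsupport
          (fun h => hy (hsub (tsupport_fderiv_subset ℝ h)))
      have hz : ‖(0 : (Fin n → ℝ) →L[ℝ] ℝ)‖ₑ = 0 := by
        rw [← ofReal_norm, norm_zero, ENNReal.ofReal_zero]
      rw [this, hz, ENNReal.zero_rpow_of_pos hs0]; exact zero_le
  calc (∫⁻ y in closedBall (0 : Fin n → ℝ) 1, ‖u y‖ₑ ^ q) ^ (1 / q)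
      = (∫⁻ y in closedBall (0 : Fin n → ℝ) 1, ‖w y‖ₑ ^ q) ^ (1 / q) := by
        congr 1
        refine setLIntegral_congr_fun measurableSet_closedBall ?_
        intro y hy
        simp only [hw]
        rw [χ.one_of_mem_closedBall hy, one_mul]
    _ ≤ (∫⁻ y, ‖w y‖ₑ ^ q) ^ (1 / q) := by
        gcongr; exact Measure.restrict_le_self
    _ ≤ S * (∫⁻ y, ‖fderiv ℝ w y‖ₑ ^ s) ^ (1 / s) := key
    _ ≤ S * ((2 ^ s * L1 ^ s : ℝ≥0) * ∫⁻ y in closedBall (0 : Fin n → ℝ) 2, (‖u y‖ₑ ^ s + ‖fderiv ℝ u y‖ₑ ^ s)) ^ (1 / s) := by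
        gcongr
        refine (lintegral_mono hDw).trans ?_
        rw [lintegral_indicator measurableSet_closedBall, lintegral_const_mul' _ _ ENNReal.coe_ne_top]
    _ = _ := by
        rw [ENNReal.mul_rpow_of_nonneg _ _ (by positivity), ENNReal.coe_mul S,
          ENNReal.coe_rpow_of_nonneg _ (by positivity : 0 ≤ 1 / s)]
        ring

lemma sob_chart {E : Type*} [NormedAddCommGroup E] [NormedSpace ℝ E]
    (n : ℕ) (hn : 0 < n) (s q : ℝ) (hs : 1 ≤ s) (hq : 0 < q)
    (hqs : q⁻¹ = s⁻¹ - (n : ℝ)⁻¹) (N : (Fin n → ℝ) → E) (hN : ContDiff ℝ 1 N) :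
    ∃ C : ℝ≥0, ∀ (v : E → ℝ) (ρ r : ℝ), ContDiff ℝ 1 v → 0 < ρ → ρ ≤ r →
      (∫⁻ y in closedBall (0 : Fin n → ℝ) 1, ‖v (r • N y)‖ₑ ^ q) ^ (1 / q) ≤
        C * (ENNReal.ofReal r ^ s * ∫⁻ y in closedBall (0 : Fin n → ℝ) 2,
          (‖fderiv ℝ v (r • N y)‖ₑ ^ s + ENNReal.ofReal (ρ ^ (-s)) * ‖v (r • N y)‖ₑ ^ s)) ^ (1 / s) := by
  have hs0 : 0 < s := by linarith
  obtain ⟨C, hC⟩ := sob_local n hn s q hs hq hqs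
  obtain ⟨L, hL⟩ := (isCompact_closedBall (0 : Fin n → ℝ) 2).exists_bound_of_continuousOn
    (hN.continuous_fderiv one_ne_zero).continuousOn
  set L1 : ℝ≥0 := L.toNNReal + 1 with hL1
  have hL1' : ∀ y ∈ closedBall (0 : Fin n → ℝ) 2, ‖fderiv ℝ N y‖ₑ ≤ L1 := by
    intro y hy
    rw [enorm_eq_nnnorm]
    refine ENNReal.coe_le_coe.2 ?_
    refine le_trans ?_ (le_add_of_nonneg_right zero_le_one)
    exact NNReal.le_toNNReal_of_coe_le (hL y hy)
  have h1L : (1 : ℝ≥0∞) ≤ L1 := by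
    rw [hL1]; push_cast; exact le_add_self
  refine ⟨C * (L1 ^ s) ^ (1 / s), ?_⟩
  intro v ρ r hv hρ hρr
  have hr : 0 < r := hρ.trans_le hρr
  have hu : ContDiff ℝ 1 (fun y => v (r • N y)) := hv.comp (contDiff_const.smul hN)
  refine (hC _ hu).trans ?_
  rw [ENNReal.coe_mul, mul_assoc]
  gcongr
  rw [ENNReal.coe_rpow_of_nonneg _ (by positivity : 0 ≤ 1 / s), ← ENNReal.mul_rpow_of_nonneg _ _ (by positivity : 0 ≤ 1 / s)]
  gcongr
  rw [← mul_assoc, ENNReal.coe_rpow_of_nonneg _ hs0.le, ← lintegral_const_mul' _ _ (by finiteness)]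
  refine setLIntegral_mono' measurableSet_closedBall ?_
  intro y hy
  have hD : ‖fderiv ℝ (fun y => v (r • N y)) y‖ₑ ≤ L1 * ENNReal.ofReal r * ‖fderiv ℝ v (r • N y)‖ₑ := by
    have h1 : HasFDerivAt (fun y => v (r • N y)) ((fderiv ℝ v (r • N y)).comp (r • fderiv ℝ N y)) y :=
      HasFDerivAt.comp y (hv.differentiable one_ne_zero _).hasFDerivAt
        ((hN.differentiable one_ne_zero y).hasFDerivAt.const_smul r)
    rw [h1.fderiv]
    refine (ContinuousLinearMap.opENorm_comp_le _ _).trans ?_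
    rw [enorm_smul, Real.enorm_eq_ofReal hr.le]
    calc _ ≤ ‖fderiv ℝ v (r • N y)‖ₑ * (ENNReal.ofReal r * L1) := by gcongr; exact hL1' y hy
      _ = _ := by ring
  have hD2 : ‖fderiv ℝ (fun y => v (r • N y)) y‖ₑ ^ s ≤
      L1 ^ s * ENNReal.ofReal r ^ s * ‖fderiv ℝ v (r • N y)‖ₑ ^ s := by
    rw [← ENNReal.mul_rpow_of_nonneg _ _ hs0.le, ← ENNReal.mul_rpow_of_nonneg _ _ hs0.le]
    gcongr
  have h3 : (1 : ℝ≥0∞) ≤ L1 ^ s := ENNReal.one_le_rpow h1L hs0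
  have h4 : (1 : ℝ≥0∞) ≤ ENNReal.ofReal r ^ s * ENNReal.ofReal (ρ ^ (-s)) := by
    rw [ENNReal.ofReal_rpow_of_pos hr, ← ENNReal.ofReal_mul (by positivity)]
    rw [ENNReal.one_le_ofReal, Real.rpow_neg hρ.le, ← div_eq_mul_inv, one_le_div (by positivity)]
    gcongr
  calc _ ≤ 1 * 1 * ‖v (r • N y)‖ₑ ^ s + L1 ^ s * ENNReal.ofReal r ^ s * ‖fderiv ℝ v (r • N y)‖ₑ ^ s := by
        rw [one_mul, one_mul]; gcongr
    _ ≤ L1 ^ s * (ENNReal.ofReal r ^ s * ENNReal.ofReal (ρ ^ (-s))) * ‖v (r • N y)‖ₑ ^ s + L1 ^ s * ENNReal.ofReal r ^ s * ‖fderiv ℝ v (r • N y)‖ₑ ^ s := by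
        gcongr
    _ = _ := by ring

noncomputable def cP {n : ℕ} (i : Fin (n + 1)) (y : Fin n → ℝ) : EuclideanSpace ℝ (Fin (n + 1)) :=
  WithLp.toLp 2 (i.insertNth (α := fun _ => ℝ) 1 y)

noncomputable def cN {n : ℕ} (i : Fin (n + 1)) (e : ℝ) (y : Fin n → ℝ) :
    EuclideanSpace ℝ (Fin (n + 1)) := (e * ‖cP i y‖⁻¹) • cP i y

lemma cP_same {n : ℕ} (i : Fin (n + 1)) (y : Fin n → ℝ) : cP i y i = 1 := by simp [cP]

lemma cP_norm {n : ℕ} (i : Fin (n + 1)) (y : Fin n → ℝ) : 1 ≤ ‖cP i y‖ := by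
  have := PiLp.norm_apply_le (cP i y) i
  simpa [cP_same] using this

lemma cP_contDiff {n : ℕ} (i : Fin (n + 1)) : ContDiff ℝ 1 (cP i) := by
  rw [contDiff_euclidean]
  intro j
  refine Fin.succAboveCases i ?_ (fun k => ?_) j
  · simp only [cP_same]; exact contDiff_const
  · simp only [cP, Fin.insertNth_apply_succAbove]; fun_prop

lemma cN_contDiff {n : ℕ} (i : Fin (n + 1)) (e : ℝ) : ContDiff ℝ 1 (cN (n := n) i e) := by
  have h0 : ∀ y : Fin n → ℝ, cP i y ≠ 0 := fun y h => by
    have := cP_norm i y; rw [h] at this; norm_num at this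
  have h1 : ContDiff ℝ 1 (fun y : Fin n → ℝ => ‖cP i y‖) := (cP_contDiff i).norm ℝ h0
  exact (contDiff_const.mul (h1.inv fun y => norm_ne_zero_iff.2 (h0 y))).smul (cP_contDiff i)

lemma cN_norm {n : ℕ} (i : Fin (n + 1)) (e : ℝ) (he : |e| = 1) (y : Fin n → ℝ) : ‖cN i e y‖ = 1 := by
  have := cP_norm i y
  rw [cN, norm_smul, norm_mul, Real.norm_eq_abs, he, norm_inv, norm_norm, one_mul]
  exact inv_mul_cancel₀ (by positivity)

lemma lint_scale {F : Type*} [NormedAddCommGroup F] [NormedSpace ℝ F] [MeasurableSpace F]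
    [BorelSpace F] [FiniteDimensional ℝ F] (m : Measure F) [m.IsAddHaarMeasure] (h : F → ℝ≥0∞)
    (hh : Measurable h) (t : ℝ) (ht : 0 < t) :
    ∫⁻ z, h z ∂m = ENNReal.ofReal (t ^ Module.finrank ℝ F) * ∫⁻ y, h (t • y) ∂m := by
  have h1 : ∫⁻ y, h (t • y) ∂m = ∫⁻ z, h z ∂(Measure.map (fun x => t • x) m) :=
    (lintegral_map hh (by fun_prop)).symm
  rw [h1, Measure.map_addHaar_smul m ht.ne', lintegral_smul_measure, smul_eq_mul, ← mul_assoc,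
    ← ENNReal.ofReal_mul (by positivity), abs_of_nonneg (by positivity), mul_inv_cancel₀ (by positivity),
    ENNReal.ofReal_one, one_mul]

lemma polar1 {n : ℕ} (i : Fin (n + 1)) (g : EuclideanSpace ℝ (Fin (n + 1)) → ℝ≥0∞)
    (hg : Measurable g) :
    ∫⁻ x in {x | 0 < x i}, g x = ∫⁻ r in Ioi (0 : ℝ), ∫⁻ y : Fin n → ℝ,
      ENNReal.ofReal (‖cP i y‖⁻¹ ^ (n + 1) * r ^ n) * g (r • cN i 1 y) := by
  have hS : MeasurableSet {x : EuclideanSpace ℝ (Fin (n + 1)) | 0 < x i} :=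
    measurableSet_lt (by fun_prop) (by fun_prop)
  have hP : Measurable (cP (n := n) i) := (cP_contDiff i).continuous.measurable
  set G := {x : EuclideanSpace ℝ (Fin (n + 1)) | 0 < x i}.indicator g with hG
  have hGm : Measurable G := hg.indicator hS
  have e1 := (PiLp.volume_preserving_toLp (Fin (n + 1))).lintegral_comp hGm
  have e2 := ((volume_preserving_piFinSuccAbove (fun _ : Fin (n + 1) => ℝ) i).symm _).lintegral_comp
    (hGm.comp (MeasurableEquiv.toLp 2 (Fin (n + 1) → ℝ)).measurable)
  rw [← lintegral_indicator hS, ← hG, ← e1]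
  erw [← e2]
  rw [Measure.volume_eq_prod, lintegral_prod]
  swap
  · exact ((hGm.comp (MeasurableEquiv.toLp 2 (Fin (n + 1) → ℝ)).measurable).comp
      (MeasurableEquiv.measurable _)).aemeasurable
  have e3 : ∀ t : ℝ, ∫⁻ z : Fin n → ℝ, G (WithLp.toLp 2 (i.insertNth (α := fun _ => ℝ) t z)) =
     (Ioi (0 : ℝ)).indicator (fun t => ∫⁻ y : Fin n → ℝ, ENNReal.ofReal (t ^ n) * g (t • cP i y)) t := by
    intro t
    by_cases ht : 0 < t
    · rw [indicator_of_mem (by exact ht)]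
      have hm : Measurable fun z : Fin n → ℝ => G (WithLp.toLp 2 (i.insertNth (α := fun _ => ℝ) t z)) := by
        refine hGm.comp ?_
        refine (MeasurableEquiv.toLp 2 (Fin (n + 1) → ℝ)).measurable.comp ?_
        exact (MeasurableEquiv.piFinSuccAbove (fun _ : Fin (n + 1) => ℝ) i).symm.measurable.comp
          (measurable_prodMk_left (x := t))
      rw [lint_scale volume _ hm t ht, Module.finrank_fin_fun, lintegral_const_mul]
      · congr 2
        ext y
        have : WithLp.toLp 2 (i.insertNth (α := fun _ => ℝ) t (t • y)) = t • cP i y := by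
          ext j
          refine Fin.succAboveCases i ?_ (fun k => ?_) j <;> simp [cP]
        rw [this, hG, indicator_of_mem]
        simp [cP_same, ht]
      · exact hg.comp (hP.const_smul t)
    · rw [indicator_of_notMem (by exact ht)]
      rw [lintegral_eq_zero_iff']
      · refine Filter.Eventually.of_forall fun z => ?_
        simp [hG, ht]
      · refine (hGm.comp ?_).aemeasurable
        refine (MeasurableEquiv.toLp 2 (Fin (n + 1) → ℝ)).measurable.comp ?_
        exact (MeasurableEquiv.piFinSuccAbove (fun _ : Fin (n + 1) => ℝ) i).symm.measurable.comp
          (measurable_prodMk_left (x := t))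
  have e4 : ∫⁻ t : ℝ, ∫⁻ z : Fin n → ℝ, G (WithLp.toLp 2 (i.insertNth (α := fun _ => ℝ) t z)) =
      ∫⁻ r in Ioi (0 : ℝ), ∫⁻ y : Fin n → ℝ,
      ENNReal.ofReal (‖cP i y‖⁻¹ ^ (n + 1) * r ^ n) * g (r • cN i 1 y) := by
    simp_rw [e3]
    rw [lintegral_indicator measurableSet_Ioi]
    have hA : Measurable (Function.uncurry fun (t : ℝ) (y : Fin n → ℝ) =>
        ENNReal.ofReal (t ^ n) * g (t • cP i y)) := by
      refine Measurable.mul ?_ (hg.comp ?_)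
      · fun_prop
      · exact measurable_fst.smul (hP.comp measurable_snd)
    have hB : Measurable (Function.uncurry fun (r : ℝ) (y : Fin n → ℝ) =>
        ENNReal.ofReal (‖cP i y‖⁻¹ ^ (n + 1) * r ^ n) * g (r • cN i 1 y)) := by
      refine Measurable.mul ?_ (hg.comp ?_)
      · have : Measurable fun x : ℝ × (Fin n → ℝ) => ‖cP i x.2‖ := (hP.comp measurable_snd).norm
        fun_prop
      · exact measurable_fst.smul ((cN_contDiff i 1).continuous.measurable.comp measurable_snd)
    refine (lintegral_lintegral_swap hA.aemeasurable).trans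
      (Eq.trans ?_ (lintegral_lintegral_swap hB.aemeasurable).symm)
    · refine lintegral_congr fun y => ?_
      have hq := cP_norm i y
      have hq0 : 0 < ‖cP i y‖⁻¹ := by positivity
      have hm : Measurable fun t : ℝ => (Ioi (0 : ℝ)).indicator (fun t => ENNReal.ofReal (t ^ n) * g (t • cP i y)) t := by
        refine Measurable.indicator ?_ measurableSet_Ioi
        exact (by fun_prop : Measurable fun t : ℝ => ENNReal.ofReal (t ^ n)).mul
          (hg.comp (measurable_id.smul_const _))
      rw [← lintegral_indicator measurableSet_Ioi, ← lintegral_indicator measurableSet_Ioi,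
        lint_scale volume _ hm _ hq0, Module.finrank_self, ← lintegral_const_mul' _ _ (by finiteness)]
      refine lintegral_congr fun r => ?_
      by_cases hr : 0 < r
      · have hr1 : r ∈ Ioi (0 : ℝ) := hr
        have hr2 : ‖cP i y‖⁻¹ • r ∈ Ioi (0 : ℝ) := smul_pos hq0 hr
        rw [indicator_of_mem hr1, indicator_of_mem hr2, ← mul_assoc,
          ← ENNReal.ofReal_mul (by positivity), cN, smul_smul, smul_eq_mul]
        congr 2 <;> ring_nf
      · have hr1 : r ∉ Ioi (0 : ℝ) := hr
        have hr2 : ‖cP i y‖⁻¹ • r ∉ Ioi (0 : ℝ) := by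
          intro h
          exact hr ((mul_pos_iff_of_pos_left hq0).1 h)
        rw [indicator_of_notMem hr1, indicator_of_notMem hr2, mul_zero]
  exact e4

lemma polar_e {n : ℕ} (i : Fin (n + 1)) (e : ℝ) (he : e = 1 ∨ e = -1)
    (g : EuclideanSpace ℝ (Fin (n + 1)) → ℝ≥0∞) (hg : Measurable g) :
    ∫⁻ x in {x | 0 < e * x i}, g x = ∫⁻ r in Ioi (0 : ℝ), ∫⁻ y : Fin n → ℝ,
      ENNReal.ofReal (‖cP i y‖⁻¹ ^ (n + 1) * r ^ n) * g (r • cN i e y) := by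
  rcases he with rfl | rfl
  · simpa using polar1 i g hg
  · have h := polar1 i (fun x => g (-x)) (hg.comp measurable_neg)
    have h2 : ∀ y : Fin n → ℝ, cN i (-1) y = - cN i 1 y := by
      intro y; simp [cN]
    simp_rw [h2, smul_neg]
    rw [← h]
    have hS : MeasurableSet {x : EuclideanSpace ℝ (Fin (n + 1)) | 0 < x i} :=
      measurableSet_lt (by fun_prop) (by fun_prop)
    have hS' : MeasurableSet {x : EuclideanSpace ℝ (Fin (n + 1)) | 0 < -1 * x i} :=
      measurableSet_lt (by fun_prop) (by fun_prop)
    rw [← lintegral_indicator hS, ← lintegral_indicator hS',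
      ← (Measure.measurePreserving_neg (volume : Measure (EuclideanSpace ℝ (Fin (n + 1))))).lintegral_comp
        (hg.indicator hS')]
    refine lintegral_congr fun x => ?_
    simp [indicator]

lemma polar_down {n : ℕ} (i : Fin (n + 1)) (e : ℝ) (he : e = 1 ∨ e = -1) :
    ∃ C : ℝ≥0, ∀ (g : EuclideanSpace ℝ (Fin (n + 1)) → ℝ≥0∞) (K : Set ℝ), Measurable g →
      MeasurableSet K → K ⊆ Ioi 0 →
      ∫⁻ r in K, ENNReal.ofReal (r ^ n) * ∫⁻ y in closedBall (0 : Fin n → ℝ) 2, g (r • cN i e y) ≤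
        C * ∫⁻ x in {x | ‖x‖ ∈ K}, g x := by
  obtain ⟨L, hL⟩ := (isCompact_closedBall (0 : Fin n → ℝ) 2).exists_bound_of_continuousOn
    ((cP_contDiff i).continuous.norm.pow (n + 1)).continuousOn
  have he1 : |e| = 1 := by rcases he with rfl | rfl <;> simp
  refine ⟨L.toNNReal, fun g K hg hK hK0 => ?_⟩
  have hT : MeasurableSet {x : EuclideanSpace ℝ (Fin (n + 1)) | ‖x‖ ∈ K} := measurable_norm hK
  have h1 := polar_e i e he _ (hg.indicator hT)
  have h2 : ∫⁻ x in {x | 0 < e * x i}, ({x | ‖x‖ ∈ K}.indicator g) x ≤ ∫⁻ x in {x | ‖x‖ ∈ K}, g x := by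
    rw [← lintegral_indicator hT]
    exact setLIntegral_le_lintegral _ _
  refine le_trans ?_ (mul_le_mul_right h2 _)
  rw [h1, ← lintegral_const_mul' _ _ ENNReal.coe_ne_top]
  refine le_trans ?_ (lintegral_mono_set hK0)
  refine setLIntegral_mono' hK fun r hr => ?_
  have hr0 : 0 < r := hK0 hr
  rw [← lintegral_const_mul' _ _ ENNReal.coe_ne_top, ← lintegral_const_mul' _ _ ENNReal.ofReal_ne_top]
  refine le_trans ?_ (setLIntegral_le_lintegral (closedBall (0 : Fin n → ℝ) 2) _)
  refine setLIntegral_mono' measurableSet_closedBall fun y hy => ?_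
  have hmem : r • cN i e y ∈ {x : EuclideanSpace ℝ (Fin (n + 1)) | ‖x‖ ∈ K} := by
    simp only [mem_ofPred_eq, norm_smul, cN_norm i e he1, mul_one, Real.norm_eq_abs, abs_of_pos hr0]
    exact hr
  rw [indicator_of_mem hmem, ← mul_assoc, ← ENNReal.ofReal_coe_nnreal,
    ← ENNReal.ofReal_mul (by positivity)]
  gcongr
  have hq := cP_norm i y
  have h3 := hL y hy
  rw [Real.norm_eq_abs, Pi.pow_apply, abs_of_nonneg (by positivity)] at h3
  rw [Real.coe_toNNReal', ← mul_assoc]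
  refine le_mul_of_one_le_left (by positivity) ?_
  calc (1 : ℝ) = ‖cP i y‖ ^ (n + 1) * ‖cP i y‖⁻¹ ^ (n + 1) := by
        rw [← mul_pow, mul_inv_cancel₀ (by positivity), one_pow]
    _ ≤ _ := by gcongr; exact h3.trans (le_max_left _ _)

noncomputable def sg (b : Bool) : ℝ := if b then 1 else -1

lemma sg_cases (b : Bool) : sg b = 1 ∨ sg b = -1 := by cases b <;> simp [sg]

lemma polar_up {n : ℕ} (g : EuclideanSpace ℝ (Fin (n + 1)) → ℝ≥0∞) (K : Set ℝ) (hg : Measurable g)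
    (hK : MeasurableSet K) (hK0 : K ⊆ Ioi 0) :
    ∫⁻ x in {x | ‖x‖ ∈ K}, g x ≤ ∑ j : Fin (n + 1) × Bool,
      ∫⁻ r in K, ENNReal.ofReal (r ^ n) *
        ∫⁻ y in closedBall (0 : Fin n → ℝ) 1, g (r • cN j.1 (sg j.2) y) := by
  have hT : MeasurableSet {x : EuclideanSpace ℝ (Fin (n + 1)) | ‖x‖ ∈ K} := measurable_norm hK
  set cone : Fin (n + 1) × Bool → Set (EuclideanSpace ℝ (Fin (n + 1))) := fun j =>
    {x | ∀ k, |x k| ≤ sg j.2 * x j.1} with hcone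
  have hcm : ∀ j, MeasurableSet (cone j) := by
    intro j
    rw [hcone]
    simp only [ofPred_forall]
    exact MeasurableSet.iInter fun k => measurableSet_le (by fun_prop) (by fun_prop)
  have hcov : {x : EuclideanSpace ℝ (Fin (n + 1)) | ‖x‖ ∈ K} ⊆
      ⋃ j : Fin (n + 1) × Bool, {x | 0 < sg j.2 * x j.1} ∩ ({x | ‖x‖ ∈ K} ∩ cone j) := by
    intro x hx
    have hx0 : x ≠ 0 := by
      rintro rfl
      have := hK0 hx
      simp at this
    obtain ⟨i, hi⟩ := Finite.exists_max (fun k => |x k|)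
    have hxi : x i ≠ 0 := by
      intro h
      apply hx0
      ext k
      have := hi k
      rw [h, abs_zero] at this
      simpa using this
    rw [mem_iUnion]
    rcases lt_or_gt_of_ne hxi with h | h
    · refine ⟨(i, false), ?_, hx, ?_⟩
      · simpa [sg] using h
      · intro k
        simpa [sg, abs_of_neg h] using hi k
    · refine ⟨(i, true), ?_, hx, ?_⟩
      · simpa [sg] using h
      · intro k
        simpa [sg, abs_of_pos h] using hi k
  refine (lintegral_mono_set hcov).trans ((lintegral_iUnion_le _ _).trans ?_)
  rw [tsum_fintype]
  refine Finset.sum_le_sum fun j _ => ?_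
  obtain ⟨i, b⟩ := j
  have he := sg_cases b
  have he1 : |sg b| = 1 := by rcases he with h | h <;> simp [h]
  have he2 : sg b * sg b = 1 := by rcases he with h | h <;> simp [h]
  simp only
  have hH : MeasurableSet {x : EuclideanSpace ℝ (Fin (n + 1)) | 0 < sg b * x i} :=
    measurableSet_lt (by fun_prop) (by fun_prop)
  have hI := hT.inter (hcm (i, b))
  have h1 := polar_e i (sg b) he _ (hg.indicator hI)
  rw [lintegral_indicator hI, Measure.restrict_restrict hI, inter_comm] at h1
  rw [h1, ← lintegral_indicator measurableSet_Ioi, ← lintegral_indicator hK]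
  refine lintegral_mono fun r => ?_
  by_cases hr : r ∈ Ioi (0 : ℝ)
  swap
  · rw [indicator_of_notMem hr]; exact zero_le
  rw [indicator_of_mem hr]
  have hr0 : 0 < r := hr
  have hnorm : ∀ y : Fin n → ℝ, ‖r • cN i (sg b) y‖ = r := by
    intro y
    simp only [norm_smul, cN_norm i _ he1, mul_one, Real.norm_eq_abs, abs_of_pos hr0]
  by_cases hrK : r ∈ K
  swap
  · rw [indicator_of_notMem hrK]
    simp [hnorm, hrK, indicator]
  rw [indicator_of_mem hrK, ← lintegral_const_mul' _ _ ENNReal.ofReal_ne_top,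
    ← lintegral_indicator measurableSet_closedBall]
  refine lintegral_mono fun y => ?_
  have hq := cP_norm i y
  have hq0 : 0 < ‖cP i y‖⁻¹ := by positivity
  by_cases hy : y ∈ closedBall (0 : Fin n → ℝ) 1
  · rw [indicator_of_mem hy]
    refine mul_le_mul' (ENNReal.ofReal_le_ofReal ?_) (indicator_le_self _ _ _)
    refine mul_le_of_le_one_left (by positivity) ?_
    exact pow_le_one₀ hq0.le (inv_le_one_of_one_le₀ hq)
  · rw [indicator_of_notMem hy, indicator_of_notMem, mul_zero]
    rintro ⟨-, hc⟩
    apply hy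
    rw [mem_closedBall_zero_iff, pi_norm_le_iff_of_nonneg zero_le_one]
    intro k
    have h := hc (i.succAbove k)
    simp only [cN, PiLp.smul_apply, smul_eq_mul, cP_same] at h
    simp only [cP, Fin.insertNth_apply_succAbove, abs_mul, he1, abs_of_pos hr0, mul_one] at h
    change r * (1 * |‖cP i y‖⁻¹| * |y k|) ≤ sg b * (r * (sg b * ‖cP i y‖⁻¹)) at h
    rw [abs_of_pos hq0] at h
    have h5 : sg b * (r * (sg b * ‖cP i y‖⁻¹)) = r * ‖cP i y‖⁻¹ * 1 := by
      linear_combination (r * ‖cP i y‖⁻¹) * he2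
    rw [h5, one_mul, ← mul_assoc] at h
    exact le_of_mul_le_mul_left h (by positivity)

lemma sector_est {n : ℕ} (hn : 2 ≤ n) (p s : ℝ) (hp : 1 < p) (hs : 1 ≤ s)
    (hps : s⁻¹ = 1 / 2 - 1 / (2 * p) + 1 / (n : ℝ)) (i : Fin (n + 1)) (e : ℝ) :
    ∃ C : ℝ≥0, ∀ (v : EuclideanSpace ℝ (Fin (n + 1)) → ℝ) (M : EuclideanSpace ℝ (Fin (n + 1)) → ℝ≥0∞)
      (ρ r : ℝ), ContDiff ℝ 1 v → Measurable M → 0 < ρ → ρ ≤ r →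
      ENNReal.ofReal (r ^ n) * ∫⁻ y in closedBall (0 : Fin n → ℝ) 1,
          M (r • cN i e y) * ‖v (r • cN i e y)‖ₑ ^ (2 : ℝ) ≤
        C * ((ENNReal.ofReal (r ^ n) * ∫⁻ y in closedBall (0 : Fin n → ℝ) 2, M (r • cN i e y) ^ p) ^ (1 / p) *
          (ENNReal.ofReal (r ^ n) * ∫⁻ y in closedBall (0 : Fin n → ℝ) 2,
          (‖fderiv ℝ v (r • cN i e y)‖ₑ ^ s + ENNReal.ofReal (ρ ^ (-s)) * ‖v (r • cN i e y)‖ₑ ^ s)) ^ (2 / s)) := by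
  have hs0 : 0 < s := by linarith
  have hp0 : 0 < p := by linarith
  have hn0 : (0 : ℝ) < n := by positivity
  obtain ⟨q, hq, hqi⟩ : ∃ q : ℝ, 0 < q ∧ q⁻¹ = 1 / 2 - 1 / (2 * p) := by
    refine ⟨(1 / 2 - 1 / (2 * p))⁻¹, ?_, inv_inv _⟩
    apply inv_pos.2
    rw [sub_pos]
    apply one_div_lt_one_div_of_lt <;> linarith
  have hNc := cN_contDiff (n := n) i e
  obtain ⟨C, hC⟩ := sob_chart n (by omega) s q hs hq (by rw [hqi, hps]; ring) (cN (n := n) i e) hNc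
  refine ⟨C ^ (2 : ℝ), fun v M ρ r hv hM hρ hρr => ?_⟩
  have hr : 0 < r := hρ.trans_le hρr
  set R := ENNReal.ofReal r with hR
  have hR0 : R ≠ 0 := by simpa [hR] using hr
  have hRt : R ≠ ∞ := by simp [hR]
  have hmN : Measurable fun y : Fin n → ℝ => r • cN i e y := hNc.continuous.measurable.const_smul r
  set B := ∫⁻ y in closedBall (0 : Fin n → ℝ) 2,
          (‖fderiv ℝ v (r • cN i e y)‖ₑ ^ s + ENNReal.ofReal (ρ ^ (-s)) * ‖v (r • cN i e y)‖ₑ ^ s) with hB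
  set A := ∫⁻ y in closedBall (0 : Fin n → ℝ) 2, M (r • cN i e y) ^ p with hA
  have key := hC v ρ r hv hρ hρr
  rw [← hB] at key
  set V := ∫⁻ y in closedBall (0 : Fin n → ℝ) 1, ‖v (r • cN i e y)‖ₑ ^ q with hV
  have hol : ∫⁻ y in closedBall (0 : Fin n → ℝ) 1,
          M (r • cN i e y) * ‖v (r • cN i e y)‖ₑ ^ (2 : ℝ) ≤ A ^ (1 / p) * V ^ (2 / q) := by
    have h := ENNReal.lintegral_mul_norm_pow_le (μ := volume.restrict (closedBall (0 : Fin n → ℝ) 1))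
      (f := fun y => M (r • cN i e y) ^ p) (g := fun y => ‖v (r • cN i e y)‖ₑ ^ q)
      ((hM.comp hmN).pow_const p).aemeasurable
      ((hv.continuous.measurable.comp hmN).enorm.pow_const q).aemeasurable
      (p := 1 / p) (q := 2 / q) (by positivity) (by positivity)
      (by rw [div_eq_mul_inv 2 q, hqi]; field_simp; ring)
    have e1 : ∀ y : Fin n → ℝ, (M (r • cN i e y) ^ p) ^ (1 / p) * (‖v (r • cN i e y)‖ₑ ^ q) ^ (2 / q) =
        M (r • cN i e y) * ‖v (r • cN i e y)‖ₑ ^ (2 : ℝ) := by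
      intro y
      rw [← ENNReal.rpow_mul, ← ENNReal.rpow_mul, mul_one_div_cancel hp0.ne', mul_div_cancel₀ _ hq.ne',
        ENNReal.rpow_one]
    simp_rw [e1] at h
    refine h.trans ?_
    gcongr
    · rw [hA]
      exact lintegral_mono_set (closedBall_subset_closedBall (by norm_num))
  have hV2 : V ^ (2 / q) ≤ C ^ (2 : ℝ) * (R ^ s * B) ^ (2 / s) := by
    calc V ^ (2 / q) = (V ^ (1 / q)) ^ (2 : ℝ) := by rw [← ENNReal.rpow_mul]; congr 1; ring
      _ ≤ (C * (R ^ s * B) ^ (1 / s)) ^ (2 : ℝ) := by gcongr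
      _ = _ := by
        rw [ENNReal.mul_rpow_of_nonneg _ _ (by norm_num), ← ENNReal.rpow_mul]; congr 2; ring
  have hRn : ENNReal.ofReal (r ^ n) = R ^ (n : ℝ) := by
    rw [hR, ENNReal.ofReal_rpow_of_pos hr, Real.rpow_natCast]
  calc _ ≤ ENNReal.ofReal (r ^ n) * (A ^ (1 / p) * (C ^ (2 : ℝ) * (R ^ s * B) ^ (2 / s))) := by
        gcongr; exact hol.trans (by gcongr)
    _ = _ := by
        rw [hRn, ENNReal.mul_rpow_of_nonneg _ _ (by positivity : 0 ≤ 2 / s),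
          ENNReal.mul_rpow_of_nonneg _ _ (by positivity : 0 ≤ 2 / s),
          ENNReal.mul_rpow_of_nonneg _ _ (by positivity : 0 ≤ 1 / p), ENNReal.coe_rpow_of_nonneg _ (by norm_num),
          ← ENNReal.rpow_mul, ← ENNReal.rpow_mul, ← ENNReal.rpow_mul]
        have h1 : R ^ (n : ℝ) * R ^ (s * (2 / s)) = R ^ ((n : ℝ) * (1 / p)) * R ^ ((n : ℝ) * (2 / s)) := by
          rw [← ENNReal.rpow_add _ _ hR0 hRt, ← ENNReal.rpow_add _ _ hR0 hRt]
          congr 1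
          rw [mul_div_cancel₀ _ hs0.ne', div_eq_mul_inv 2 s, hps]
          field_simp
          ring
        calc _ = (R ^ (n : ℝ) * R ^ (s * (2 / s))) * (A ^ (1 / p) * C ^ (2 : ℝ) * B ^ (2 / s)) := by ring
          _ = _ := by rw [h1]; ring

lemma core {n : ℕ} (hn : 2 ≤ n) (p s γ : ℝ) (hp : 1 < p) (hs : 1 ≤ s)
    (hps : s⁻¹ = 1 / 2 - 1 / (2 * p) + 1 / (n : ℝ)) (hγ : 0 < γ) (hγ1 : γ * (1 / p) + γ * (2 / s) = 1) :
    ∃ C : ℝ≥0, ∀ (v : EuclideanSpace ℝ (Fin (n + 1)) → ℝ) (M : EuclideanSpace ℝ (Fin (n + 1)) → ℝ≥0∞)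
      (ρ σ : ℝ), ContDiff ℝ 1 v → Measurable M → 0 < ρ → ρ < σ →
      ∃ F : ℝ → ℝ≥0∞, Measurable F ∧
        (∫⁻ r in Ioo ρ σ, F r ≤ C * ((∫⁻ x in {x | ‖x‖ ∈ Ioo ρ σ}, M x ^ p) ^ (γ * (1 / p)) *
          (∫⁻ x in {x | ‖x‖ ∈ Ioo ρ σ}, (‖fderiv ℝ v x‖ₑ ^ s + ENNReal.ofReal (ρ ^ (-s)) * ‖v x‖ₑ ^ s)) ^
            (γ * (2 / s)))) ∧
        ∀ K : Set ℝ, MeasurableSet K → K ⊆ Ioo ρ σ →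
          ∫⁻ x in {x | ‖x‖ ∈ K}, M x * ‖v x‖ₑ ^ (2 : ℝ) ≤ C * ∫⁻ r in K, F r ^ (1 / γ) := by
  have hs0 : 0 < s := by linarith
  have hp0 : 0 < p := by linarith
  choose C1 hC1 using fun j : Fin (n + 1) × Bool => sector_est hn p s hp hs hps j.1 (sg j.2)
  choose C2 hC2 using fun j : Fin (n + 1) × Bool => polar_down (n := n) j.1 (sg j.2) (sg_cases j.2)
  refine ⟨∑ j, C1 j + ∑ j, C2 j, fun v M ρ σ hv hM hρ hρσ => ?_⟩
  set B : EuclideanSpace ℝ (Fin (n + 1)) → ℝ≥0∞ := fun x =>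
    ‖fderiv ℝ v x‖ₑ ^ s + ENNReal.ofReal (ρ ^ (-s)) * ‖v x‖ₑ ^ s with hB
  have hBm : Measurable B := by
    have h1 : Measurable fun x => ‖fderiv ℝ v x‖ₑ := (hv.continuous_fderiv one_ne_zero).enorm.measurable
    have h2 : Measurable fun x => ‖v x‖ₑ := hv.continuous.enorm.measurable
    exact (h1.pow_const s).add ((h2.pow_const s).const_mul _)
  have hAm : Measurable fun x => M x ^ p := hM.pow_const p
  have hmeas : ∀ (g : EuclideanSpace ℝ (Fin (n + 1)) → ℝ≥0∞) (j : Fin (n + 1) × Bool), Measurable g →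
      Measurable fun r : ℝ => ENNReal.ofReal (r ^ n) * ∫⁻ y in closedBall (0 : Fin n → ℝ) 2,
        g (r • cN j.1 (sg j.2) y) := by
    intro g j hg
    refine Measurable.mul (by fun_prop) ?_
    refine Measurable.lintegral_prod_right' (f := fun z : ℝ × (Fin n → ℝ) => g (z.1 • cN j.1 (sg j.2) z.2)) ?_
    refine hg.comp (measurable_fst.smul ?_)
    exact (cN_contDiff j.1 (sg j.2)).continuous.measurable.comp measurable_snd
  set a : Fin (n + 1) × Bool → ℝ → ℝ≥0∞ := fun j r => ENNReal.ofReal (r ^ n) *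
    ∫⁻ y in closedBall (0 : Fin n → ℝ) 2, M (r • cN j.1 (sg j.2) y) ^ p with ha
  set b : Fin (n + 1) × Bool → ℝ → ℝ≥0∞ := fun j r => ENNReal.ofReal (r ^ n) *
    ∫⁻ y in closedBall (0 : Fin n → ℝ) 2, B (r • cN j.1 (sg j.2) y) with hb
  have ham : ∀ j, Measurable (a j) := fun j => hmeas _ j hAm
  have hbm : ∀ j, Measurable (b j) := fun j => hmeas _ j hBm
  have hI0 : Ioo ρ σ ⊆ Ioi 0 := fun r hr => hρ.trans hr.1
  set F : Fin (n + 1) × Bool → ℝ → ℝ≥0∞ := fun j r => a j r ^ (γ * (1 / p)) * b j r ^ (γ * (2 / s)) with hF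
  have hFm : ∀ j, Measurable (F j) := fun j => ((ham j).pow_const _).mul ((hbm j).pow_const _)
  refine ⟨fun r => ∑ j, F j r, Finset.measurable_sum _ fun j _ => hFm j, ?_, ?_⟩
  · rw [lintegral_finsetSum _ fun j _ => hFm j]
    refine le_trans ?_ (mul_le_mul' (ENNReal.coe_le_coe.2 (le_add_self : ∑ j, C2 j ≤ ∑ j, C1 j + ∑ j, C2 j)) le_rfl)
    rw [ENNReal.ofNNReal_finsetSum, Finset.sum_mul]
    refine Finset.sum_le_sum fun j _ => ?_
    refine (ENNReal.lintegral_mul_norm_pow_le (ham j).aemeasurable (hbm j).aemeasurable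
      (by positivity) (by positivity) hγ1).trans ?_
    have h1 := hC2 j _ _ hAm measurableSet_Ioo hI0
    have h2 := hC2 j _ _ hBm measurableSet_Ioo hI0
    calc _ ≤ (C2 j * ∫⁻ x in {x | ‖x‖ ∈ Ioo ρ σ}, M x ^ p) ^ (γ * (1 / p)) *
          (C2 j * ∫⁻ x in {x | ‖x‖ ∈ Ioo ρ σ}, B x) ^ (γ * (2 / s)) := by gcongr
      _ = ((C2 j : ℝ≥0∞) ^ (γ * (1 / p)) * (C2 j : ℝ≥0∞) ^ (γ * (2 / s))) * _ := by
        rw [ENNReal.mul_rpow_of_nonneg _ _ (by positivity), ENNReal.mul_rpow_of_nonneg _ _ (by positivity),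
          mul_mul_mul_comm]
      _ = _ := by
        rw [← ENNReal.rpow_add_of_nonneg _ _ (by positivity) (by positivity), hγ1, ENNReal.rpow_one]
  · intro K hK hKI
    have hm : Measurable fun x => M x * ‖v x‖ₑ ^ (2 : ℝ) :=
      hM.mul (hv.continuous.enorm.measurable.pow_const _)
    refine (polar_up _ K hm hK (hKI.trans hI0)).trans ?_
    refine le_trans ?_ (mul_le_mul' (ENNReal.coe_le_coe.2 (le_self_add : ∑ j, C1 j ≤ ∑ j, C1 j + ∑ j, C2 j)) le_rfl)
    rw [ENNReal.ofNNReal_finsetSum, Finset.sum_mul]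
    refine Finset.sum_le_sum fun j _ => ?_
    rw [← lintegral_const_mul' _ _ ENNReal.coe_ne_top]
    refine setLIntegral_mono' hK fun r hr => ?_
    refine (hC1 j v M ρ r hv hM hρ (hKI hr).1.le).trans ?_
    gcongr
    calc _ = F j r ^ (1 / γ) := by
          rw [hF]
          simp only
          rw [ENNReal.mul_rpow_of_nonneg _ _ (by positivity : 0 ≤ 1 / γ), ← ENNReal.rpow_mul, ← ENNReal.rpow_mul]
          congr 2 <;> field_simp
      _ ≤ _ := by
          gcongr
          exact Finset.single_le_sum (f := fun j => F j r) (fun _ _ => zero_le) (Finset.mem_univ j)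

lemma select (ρ σ : ℝ) (h : ρ < σ) (F : ℝ → ℝ≥0∞) (hF : Measurable F)
    (hX : ∫⁻ r in Ioo ρ σ, F r ≠ ∞) :
    ∃ K : Set ℝ, IsCompact K ∧ K ⊆ Ioo ρ σ ∧ ENNReal.ofReal ((σ - ρ) / 4) < volume K ∧
      ∀ r ∈ K, F r ≤ ENNReal.ofReal (2 / (σ - ρ)) * ∫⁻ r in Ioo ρ σ, F r := by
  set X := ∫⁻ r in Ioo ρ σ, F r with hXd
  set T := ENNReal.ofReal (2 / (σ - ρ)) * X with hT
  have hL : 0 < σ - ρ := sub_pos.2 h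
  have hm : MeasurableSet {r | F r ≤ T} := measurableSet_le hF measurable_const
  have hm' : MeasurableSet {r | T < F r} := measurableSet_lt measurable_const hF
  have hbad : volume ({r | T < F r} ∩ Ioo ρ σ) ≤ ENNReal.ofReal ((σ - ρ) / 2) := by
    rw [← Measure.restrict_apply hm']
    by_cases hX0 : X = 0
    · have h0 : F =ᵐ[volume.restrict (Ioo ρ σ)] 0 := (lintegral_eq_zero_iff hF).1 hX0
      have : volume.restrict (Ioo ρ σ) {r | T < F r} = 0 := by
        rw [measure_eq_zero_iff_ae_notMem]
        filter_upwards [h0] with r hr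
        simp [hr]
      rw [this]; exact zero_le
    · have h1 := mul_meas_ge_le_lintegral (μ := volume.restrict (Ioo ρ σ)) hF T
      have h2 : T * volume.restrict (Ioo ρ σ) {r | T < F r} ≤ X :=
        le_trans (by gcongr with r hr; intro hr; exact hr.le) h1
      have h3 : X = T * ENNReal.ofReal ((σ - ρ) / 2) := by
        rw [hT, mul_right_comm, ← ENNReal.ofReal_mul (by positivity)]
        have : 2 / (σ - ρ) * ((σ - ρ) / 2) = 1 := by field_simp
        rw [this, ENNReal.ofReal_one, one_mul]
      rw [h3] at h2
      refine (ENNReal.mul_le_mul_iff_right ?_ ?_).1 h2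
      · refine mul_ne_zero ?_ hX0
        simpa using hL
      · exact ENNReal.mul_ne_top ENNReal.ofReal_ne_top hX
  have hgood : ENNReal.ofReal ((σ - ρ) / 4) < volume ({r | F r ≤ T} ∩ Ioo ρ σ) := by
    by_contra hc
    push Not at hc
    have h1 : volume (Ioo ρ σ) ≤ volume ({r | F r ≤ T} ∩ Ioo ρ σ) + volume ({r | T < F r} ∩ Ioo ρ σ) := by
      refine (measure_mono ?_).trans (measure_union_le _ _)
      intro r hr
      rcases le_or_gt (F r) T with h | h
      · exact Or.inl ⟨h, hr⟩
      · exact Or.inr ⟨h, hr⟩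
    have h2 := h1.trans (add_le_add hc hbad)
    rw [Real.volume_Ioo, ← ENNReal.ofReal_add (by positivity) (by positivity),
      ENNReal.ofReal_le_ofReal_iff (by positivity)] at h2
    linarith
  obtain ⟨K, hKs, hKc, hK⟩ := (hm.inter measurableSet_Ioo).exists_lt_isCompact hgood
  exact ⟨K, hKc, fun r hr => (hKs hr).2, hK, fun r hr => (hKs hr).1⟩

lemma cutoff {d : ℕ} (ρ σ : ℝ) (hρ : 0 < ρ) (w : EuclideanSpace ℝ (Fin d) → ℝ) (hw : Measurable w)
    (hw0 : ∀ x, 0 ≤ w x)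
    (hwi : IntegrableOn w (ball (0 : EuclideanSpace ℝ (Fin d)) σ))
    (K : Set ℝ) (hKc : IsCompact K) (hK : K ⊆ Ioo ρ σ) (hKpos : 0 < volume.real K) (ε : ℝ) (hε : 0 < ε) :
    ∃ η : EuclideanSpace ℝ (Fin d) → ℝ, ContDiff ℝ 1 η ∧
          HasCompactSupport η ∧ tsupport η ⊆ ball (0 : EuclideanSpace ℝ (Fin d)) σ ∧
          (∀ x, 0 ≤ η x) ∧
          (∀ x ∈ closedBall (0 : EuclideanSpace ℝ (Fin d)) ρ, η x = 1) ∧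
          ∫ x in ball (0 : EuclideanSpace ℝ (Fin d)) σ, w x * ‖gradient η x‖ ^ 2 ≤
            (volume.real K)⁻¹ ^ 2 * ((∫⁻ x in {x | ‖x‖ ∈ K}, ENNReal.ofReal (w x)).toReal + ε) := by
  set Ω := ball (0 : EuclideanSpace ℝ (Fin d)) σ with hΩ
  have hfin : ∫⁻ x in Ω, ENNReal.ofReal (w x) ≠ ∞ := hwi.lintegral_lt_top.ne
  set m := (volume.restrict Ω).withDensity (fun x => ENNReal.ofReal (w x)) with hm
  have : IsFiniteMeasure m := isFiniteMeasure_withDensity hfin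
  set ν := m.map norm with hν
  have hνU : ∀ U : Set ℝ, MeasurableSet U → ν U = ∫⁻ x in {x | ‖x‖ ∈ U} ∩ Ω, ENNReal.ofReal (w x) := by
    intro U hU
    have hU' : MeasurableSet {x : EuclideanSpace ℝ (Fin d) | ‖x‖ ∈ U} := measurable_norm hU
    rw [hν, Measure.map_apply measurable_norm hU, hm]
    change (Measure.withDensity _ _) {x : EuclideanSpace ℝ (Fin d) | ‖x‖ ∈ U} = _
    rw [withDensity_apply _ hU', Measure.restrict_restrict hU']
  obtain ⟨U, hKU, hUo, hU⟩ := K.exists_isOpen_lt_add (μ := ν) (measure_ne_top _ _)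
    (ε := ENNReal.ofReal ε) (by simpa using hε)
  obtain ⟨φ, hφ1, hφc, hφ01, hφs⟩ : ∃ φ : C(ℝ, ℝ), EqOn φ 1 K ∧ HasCompactSupport φ ∧
      (∀ x, φ x ∈ Icc (0 : ℝ) 1) ∧ tsupport φ ⊆ U ∩ Ioo ρ σ := by
    have hcl : IsCompact (closure (U ∩ Ioo ρ σ)) :=
      ((isBounded_Ioo ρ σ).subset inter_subset_right).isCompact_closure
    obtain ⟨φ, h1, h2, h3⟩ := exists_tsupport_one_of_isOpen_isClosed (hUo.inter isOpen_Ioo) hcl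
      hKc.isClosed (subset_inter hKU hK)
    exact ⟨φ, h2, hcl.of_isClosed_subset (isClosed_tsupport _) (h1.trans subset_closure), h3, h1⟩
  have hφout : ∀ t, t ∉ U ∩ Ioo ρ σ → φ t = 0 := fun t ht =>
    image_eq_zero_of_notMem_tsupport fun h => ht (hφs h)
  have hφi : Integrable φ := φ.continuous.integrable_of_hasCompactSupport hφc
  set Z := ∫ t, φ t with hZ
  have hZK : volume.real K ≤ Z := by
    have h1 : ∫ t in K, φ t = volume.real K := by
      rw [setIntegral_congr_fun hKc.measurableSet hφ1]; simp
    rw [← h1]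
    exact setIntegral_le_integral hφi (Filter.Eventually.of_forall fun t => (hφ01 t).1)
  have hZ0 : 0 < Z := hKpos.trans_le hZK
  set H : ℝ → ℝ := fun t => Z⁻¹ * ∫ u in t..σ, φ u with hH
  have hHd : ∀ t, HasDerivAt H (Z⁻¹ * (-φ t)) t := fun t =>
    (intervalIntegral.integral_hasDerivAt_left (φ.continuous.intervalIntegrable _ _)
      φ.continuous.stronglyMeasurable.stronglyMeasurableAtFilter φ.continuous.continuousAt).const_mul _
  have hHC : ContDiff ℝ 1 H := by
    rw [contDiff_one_iff_deriv]
    refine ⟨fun t => (hHd t).differentiableAt, ?_⟩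
    have : deriv H = fun t => Z⁻¹ * (-φ t) := funext fun t => (hHd t).deriv
    rw [this]
    have := φ.continuous
    fun_prop
  have hH1 : ∀ t ≤ ρ, H t = 1 := by
    intro t ht
    have : ∫ u in t..σ, φ u = Z := by
      rw [hZ]
      apply intervalIntegral.integral_eq_integral_of_support_subset
      intro u hu
      by_contra hc
      refine hu (hφout u fun h => hc ?_)
      exact ⟨ht.trans_lt h.2.1, h.2.2.le⟩
    simp only [hH, this]
    exact inv_mul_cancel₀ hZ0.ne'
  have hHnn : ∀ t, 0 ≤ H t := by
    intro t
    refine mul_nonneg (by positivity) ?_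
    rcases le_total t σ with h | h
    · exact intervalIntegral.integral_nonneg h fun u _ => (hφ01 u).1
    · rw [intervalIntegral.integral_symm, intervalIntegral.integral_zero_ae]
      · simp
      · refine Filter.Eventually.of_forall fun u hu => hφout u fun h' => ?_
        rw [uIoc_of_le h] at hu
        exact absurd h'.2.2 (not_lt.2 hu.1.le)
  obtain ⟨τ, hτσ, hτ⟩ : ∃ τ < σ, ∀ t, τ ≤ t → H t = 0 := by
    obtain ⟨τ, hτσ, hτ⟩ : ∃ τ < σ, ∀ t ∈ tsupport φ, t ≤ τ := by
      by_cases hne : (tsupport φ).Nonempty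
      · obtain ⟨τ, hτ, hmax⟩ := hφc.exists_isMaxOn hne continuousOn_id
        exact ⟨τ, (hφs hτ).2.2, fun t ht => hmax ht⟩
      · exact ⟨σ - 1, by linarith, fun t ht => absurd ⟨t, ht⟩ hne⟩
    refine ⟨τ, hτσ, fun t ht => ?_⟩
    simp only [hH]
    rw [intervalIntegral.integral_zero_ae, mul_zero]
    refine Filter.Eventually.of_forall fun u hu => ?_
    by_contra hc
    have h1 := hτ u (subset_tsupport _ hc)
    have h2 : u ∈ Ioo ρ σ := by
      by_contra h; exact hc (hφout u fun h' => h h'.2)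
    rcases le_total t σ with h | h
    · rw [uIoc_of_le h] at hu; linarith [hu.1]
    · rw [uIoc_of_ge h] at hu; linarith [hu.1, h2.2]
  set η : EuclideanSpace ℝ (Fin d) → ℝ := fun x => H ‖x‖ with hη
  have hηts : tsupport η ⊆ closedBall 0 τ := by
    refine closure_minimal ?_ isClosed_closedBall
    intro x hx
    rw [mem_closedBall_zero_iff]
    by_contra hc
    exact hx (hτ _ (not_le.1 hc).le)
  have hη0 : ∀ x ∈ ball (0 : EuclideanSpace ℝ (Fin d)) ρ, η =ᶠ[nhds x] fun _ => 1 := by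
    intro x hx
    filter_upwards [isOpen_ball.mem_nhds hx] with y hy
    exact hH1 _ (mem_ball_zero_iff.1 hy).le
  refine ⟨η, ?_, ?_, ?_, fun x => hHnn _, fun x hx => hH1 _ (mem_closedBall_zero_iff.1 hx), ?_⟩
  · rw [contDiff_iff_contDiffAt]
    intro x
    by_cases hx : x = 0
    · exact contDiffAt_const.congr_of_eventuallyEq (hη0 x (by rw [hx]; exact mem_ball_self hρ))
    · exact hHC.contDiffAt.comp x (contDiffAt_norm ℝ hx)
  · exact HasCompactSupport.intro' (isCompact_closedBall 0 τ) isClosed_closedBall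
      fun x hx => image_eq_zero_of_notMem_tsupport fun h => hx (hηts h)
  · exact hηts.trans (closedBall_subset_ball hτσ)
  have hgrad : ∀ x, ‖gradient η x‖ ≤ Z⁻¹ * φ ‖x‖ := by
    intro x
    have hng : ‖gradient η x‖ = ‖fderiv ℝ η x‖ := by simp [gradient]
    rw [hng]
    by_cases hx : x = 0
    · rw [(hη0 x (by rw [hx]; exact mem_ball_self hρ)).fderiv_eq]
      simp only [fderiv_fun_const, Pi.zero_apply, norm_zero]
      exact mul_nonneg (by positivity) (hφ01 _).1
    · have h1 : HasFDerivAt (fun x : EuclideanSpace ℝ (Fin d) => ‖x‖) (fderiv ℝ norm x) x :=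
        ((contDiffAt_norm ℝ hx (n := 1)).differentiableAt one_ne_zero).hasFDerivAt
      have h2 : HasFDerivAt η ((Z⁻¹ * (-φ ‖x‖)) • fderiv ℝ norm x) x :=
        (hHd ‖x‖).comp_hasFDerivAt x h1
      rw [h2.fderiv, norm_smul]
      have h3 : ‖fderiv ℝ (norm : EuclideanSpace ℝ (Fin d) → ℝ) x‖ ≤ 1 := by
        simpa using norm_fderiv_le_of_lipschitz ℝ (lipschitzWith_one_norm (E := EuclideanSpace ℝ (Fin d))) (x₀ := x)
      rw [norm_mul, norm_neg, Real.norm_of_nonneg (by positivity : 0 ≤ Z⁻¹), Real.norm_of_nonneg (hφ01 _).1]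
      exact mul_le_of_le_one_right (mul_nonneg (by positivity) (hφ01 _).1) h3
  have hU' : MeasurableSet {x : EuclideanSpace ℝ (Fin d) | ‖x‖ ∈ U} := measurable_norm hUo.measurableSet
  calc ∫ x in Ω, w x * ‖gradient η x‖ ^ 2
      ≤ ∫ x in Ω, Z⁻¹ ^ 2 * {x | ‖x‖ ∈ U}.indicator w x := by
        refine integral_mono_of_nonneg (Filter.Eventually.of_forall fun x => ?_)
          ((hwi.indicator hU').const_mul _) (Filter.Eventually.of_forall fun x => ?_)
        · exact mul_nonneg (hw0 x) (by positivity)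
        · simp only
          by_cases hx : ‖x‖ ∈ U
          · rw [indicator_of_mem (by exact hx), mul_comm]
            have : ‖gradient η x‖ ≤ Z⁻¹ := (hgrad x).trans
              (mul_le_of_le_one_right (by positivity) (hφ01 _).2)
            have := hw0 x
            gcongr
          · have h0 : ‖gradient η x‖ = 0 := by
              refine le_antisymm ((hgrad x).trans ?_) (norm_nonneg _)
              rw [hφout _ fun h => hx h.1, mul_zero]
            rw [indicator_of_notMem (by exact hx), h0]; simp
    _ = Z⁻¹ ^ 2 * (ν U).toReal := by
        rw [integral_const_mul, integral_indicator hU', Measure.restrict_restrict hU',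
          hνU U hUo.measurableSet, integral_eq_lintegral_of_nonneg_ae
          (Filter.Eventually.of_forall hw0) hw.aestronglyMeasurable]
    _ ≤ (volume.real K)⁻¹ ^ 2 * ((ν K).toReal + ε) := by
        have h1 : (ν U).toReal ≤ (ν K).toReal + ε := by
          have := ENNReal.toReal_mono (by finiteness) hU.le
          rwa [ENNReal.toReal_add (by finiteness) (by finiteness), ENNReal.toReal_ofReal hε.le] at this
        gcongr
    _ = _ := by
        rw [hνU K hKc.measurableSet]
        congr 5
        ext x
        refine ⟨fun h => h.1, fun h => ⟨h, ?_⟩⟩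
        rw [hΩ, mem_ball_zero_iff]
        exact (hK h).2

set_option maxHeartbeats 4000000

theorem stmt_7 (d : ℕ) (hd : 3 ≤ d) (p : ℝ) (hp : ((d : ℝ) - 1) / 2 < p) :
    ∃ c : ℝ, 0 < c ∧
      ∀ (ρ σ : ℝ), 0 < ρ → ρ < σ →
      ∀ (v μ : EuclideanSpace ℝ (Fin d) → ℝ), ContDiff ℝ 1 v → Measurable μ →
      (∀ x, 0 ≤ μ x) →
      IntegrableOn (fun x => μ x ^ p) (ball (0 : EuclideanSpace ℝ (Fin d)) σ) →
      sInf {I : ℝ | ∃ η : EuclideanSpace ℝ (Fin d) → ℝ, ContDiff ℝ 1 η ∧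
          HasCompactSupport η ∧ tsupport η ⊆ ball (0 : EuclideanSpace ℝ (Fin d)) σ ∧
          (∀ x, 0 ≤ η x) ∧
          (∀ x ∈ closedBall (0 : EuclideanSpace ℝ (Fin d)) ρ, η x = 1) ∧
          I = ∫ x in ball (0 : EuclideanSpace ℝ (Fin d)) σ,
                μ x * (v x) ^ 2 * ‖gradient η x‖ ^ 2} ≤
        c * (σ - ρ) ^ (-(2 * (d : ℝ) / ((d : ℝ) - 1))) *
          (∫ x in ball (0 : EuclideanSpace ℝ (Fin d)) σ \
              ball (0 : EuclideanSpace ℝ (Fin d)) ρ, μ x ^ p) ^ (1 / p) *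
          ((∫ x in ball (0 : EuclideanSpace ℝ (Fin d)) σ \
                ball (0 : EuclideanSpace ℝ (Fin d)) ρ,
              ‖gradient v x‖ ^ ((min (1/2 - 1/(2*p) + 1/((d:ℝ)-1)) 1)⁻¹)) ^
                (2 * min (1/2 - 1/(2*p) + 1/((d:ℝ)-1)) 1) +
            ρ ^ (-2 : ℝ) *
            (∫ x in ball (0 : EuclideanSpace ℝ (Fin d)) σ \
                ball (0 : EuclideanSpace ℝ (Fin d)) ρ,
              |v x| ^ ((min (1/2 - 1/(2*p) + 1/((d:ℝ)-1)) 1)⁻¹)) ^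
                (2 * min (1/2 - 1/(2*p) + 1/((d:ℝ)-1)) 1)) := by
  obtain ⟨n, rfl⟩ : ∃ n, d = n + 1 := ⟨d - 1, by omega⟩
  have hn : 2 ≤ n := by omega
  have hn2 : (2 : ℝ) ≤ n := by exact_mod_cast hn
  have hn0 : (0 : ℝ) < n := by linarith
  have hdn : ((n + 1 : ℕ) : ℝ) - 1 = n := by push_cast; ring
  rw [hdn] at hp ⊢
  have hp1 : 1 < p := by linarith
  have hp0 : 0 < p := by linarith
  have hnp : 1 / (2 * p) < 1 / (n : ℝ) := one_div_lt_one_div_of_lt hn0 (by linarith)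
  have hn12 : 1 / (n : ℝ) ≤ 1 / 2 := one_div_le_one_div_of_le (by norm_num) hn2
  have hp00 : 0 < 1 / (2 * p) := by positivity
  obtain ⟨θ, hθ⟩ : ∃ θ, θ = 1 / 2 - 1 / (2 * p) + 1 / (n : ℝ) := ⟨_, rfl⟩
  have hθ1 : θ ≤ 1 := by linarith
  have hθ0 : 0 < θ := by linarith
  rw [← hθ, min_eq_left hθ1]
  obtain ⟨s, hs⟩ : ∃ s, s = θ⁻¹ := ⟨_, rfl⟩
  have hsθ : s⁻¹ = θ := by rw [hs, inv_inv]
  have hs1 : 1 ≤ s := by rw [hs]; exact (one_le_inv₀ hθ0).2 hθ1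
  have hs0 : 0 < s := by linarith
  have h2s : 2 * θ = 2 / s := by rw [← hsθ]; ring
  rw [← hs, h2s]
  obtain ⟨γ, hγ⟩ : ∃ γ : ℝ, γ = n / (n + 2) := ⟨_, rfl⟩
  have hγ0 : 0 < γ := by rw [hγ]; positivity
  have hγ1 : γ * (1 / p) + γ * (2 / s) = 1 := by
    rw [← h2s, hθ, hγ]; field_simp; ring
  have hexp : -(2 * ((n + 1 : ℕ) : ℝ) / n) = -1 + -(1 / γ) := by
    rw [hγ]; push_cast; field_simp; ring
  rw [hexp]
  obtain ⟨C, hC⟩ := core hn p s γ hp1 hs1 (by rw [hsθ, hθ]) hγ0 hγ1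
  refine ⟨4 * C * (2 * C) ^ (1 / γ) * 2 ^ (2 / s) + 1, by positivity, ?_⟩
  intro ρ σ hρ hρσ v μ hv hμm hμ0 hμi
  have hL : 0 < σ - ρ := sub_pos.2 hρσ
  set Ω := ball (0 : EuclideanSpace ℝ (Fin (n + 1))) σ with hΩ
  set D := Ω \ ball (0 : EuclideanSpace ℝ (Fin (n + 1))) ρ with hD
  have hDm : MeasurableSet D := measurableSet_ball.diff measurableSet_ball
  have hDΩ : D ⊆ closedBall 0 σ := sdiff_subset.trans ball_subset_closedBall
  have hDsub : {x : EuclideanSpace ℝ (Fin (n + 1)) | ‖x‖ ∈ Ioo ρ σ} ⊆ D := by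
    intro x hx
    refine ⟨mem_ball_zero_iff.2 hx.2, fun h => ?_⟩
    exact absurd (mem_ball_zero_iff.1 h) (not_lt.2 hx.1.le)
  set M : EuclideanSpace ℝ (Fin (n + 1)) → ℝ≥0∞ := fun x => ENNReal.ofReal (μ x) with hM
  have hMm : Measurable M := hμm.ennreal_ofReal
  obtain ⟨F, hFm, hFX, hFK⟩ := hC v M ρ σ hv hMm hρ hρσ
  have hgn : ∀ x, ‖gradient v x‖ = ‖fderiv ℝ v x‖ := fun x => by simp [gradient]
  simp_rw [hgn]
  set A := ∫ x in D, μ x ^ p with hA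
  set G := ∫ x in D, ‖fderiv ℝ v x‖ ^ s with hG
  set V := ∫ x in D, |v x| ^ s with hV
  have hA0 : 0 ≤ A := integral_nonneg fun x => Real.rpow_nonneg (hμ0 x) _
  have hG0 : 0 ≤ G := integral_nonneg fun x => by positivity
  have hV0 : 0 ≤ V := integral_nonneg fun x => by positivity
  have hGc : Continuous fun x => ‖fderiv ℝ v x‖ ^ s :=
    (hv.continuous_fderiv one_ne_zero).norm.rpow_const fun _ => Or.inr hs0.le
  have hVc : Continuous fun x => |v x| ^ s := hv.continuous.abs.rpow_const fun _ => Or.inr hs0.le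
  have hGi : IntegrableOn (fun x => ‖fderiv ℝ v x‖ ^ s) D :=
    (hGc.continuousOn.integrableOn_compact (isCompact_closedBall 0 σ)).mono_set hDΩ
  have hVi : IntegrableOn (fun x => |v x| ^ s) D :=
    (hVc.continuousOn.integrableOn_compact (isCompact_closedBall 0 σ)).mono_set hDΩ
  have hAi : IntegrableOn (fun x => μ x ^ p) D := hμi.mono_set sdiff_subset
  have hAl : ∫⁻ x in {x | ‖x‖ ∈ Ioo ρ σ}, M x ^ p ≤ ENNReal.ofReal A := by
    refine (lintegral_mono_set hDsub).trans ?_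
    rw [hA, ofReal_integral_eq_lintegral_ofReal hAi
      (Filter.Eventually.of_forall fun x => Real.rpow_nonneg (hμ0 x) _)]
    refine lintegral_mono fun x => ?_
    rw [hM]
    simp only
    rw [ENNReal.ofReal_rpow_of_nonneg (hμ0 x) hp0.le]
  set B := G + ρ ^ (-s) * V with hB
  have hB0 : 0 ≤ B := by positivity
  have hBl : ∫⁻ x in {x | ‖x‖ ∈ Ioo ρ σ}, (‖fderiv ℝ v x‖ₑ ^ s + ENNReal.ofReal (ρ ^ (-s)) * ‖v x‖ₑ ^ s) ≤
      ENNReal.ofReal B := by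
    refine (lintegral_mono_set hDsub).trans ?_
    have hsum : Integrable (fun x => ‖fderiv ℝ v x‖ ^ s + ρ ^ (-s) * |v x| ^ s) (volume.restrict D) :=
      hGi.add (hVi.const_mul _)
    rw [hB, hG, hV, ← integral_const_mul, ← integral_add hGi (hVi.const_mul _),
      ofReal_integral_eq_lintegral_ofReal hsum
      (Filter.Eventually.of_forall fun x => add_nonneg (by positivity) (by positivity))]
    refine lintegral_mono fun x => ?_
    rw [ENNReal.ofReal_add (by positivity) (by positivity), ENNReal.ofReal_mul (by positivity),
      ← ENNReal.ofReal_rpow_of_nonneg (norm_nonneg _) hs0.le,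
      ← ENNReal.ofReal_rpow_of_nonneg (abs_nonneg _) hs0.le, ofReal_norm, ← Real.norm_eq_abs, ofReal_norm]
  set X' : ℝ := C * (A ^ (γ * (1 / p)) * B ^ (γ * (2 / s))) with hX'
  have hX'0 : 0 ≤ X' := by positivity
  have hXle : ∫⁻ r in Ioo ρ σ, F r ≤ ENNReal.ofReal X' := by
    refine hFX.trans ?_
    rw [hX', ENNReal.ofReal_mul (by positivity), ENNReal.ofReal_mul (by positivity), ENNReal.ofReal_coe_nnreal,
      ← ENNReal.ofReal_rpow_of_nonneg hA0 (by positivity), ← ENNReal.ofReal_rpow_of_nonneg hB0 (by positivity)]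
    gcongr
  obtain ⟨K, hKc, hKI, hKL, hKF⟩ := select ρ σ hρσ F hFm (ne_top_of_le_ne_top ENNReal.ofReal_ne_top hXle)
  set T : ℝ := 2 / (σ - ρ) * X' with hT
  have hT0 : 0 ≤ T := by positivity
  have hKF' : ∀ r ∈ K, F r ≤ ENNReal.ofReal T := by
    intro r hr
    refine (hKF r hr).trans ?_
    rw [hT, ENNReal.ofReal_mul (by positivity)]
    gcongr
  set k := volume.real K with hk
  have hKfin : volume K ≠ ∞ := hKc.measure_lt_top.ne
  have hkL : (σ - ρ) / 4 < k := by
    rw [hk, measureReal_def]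
    exact (ENNReal.ofReal_lt_iff_lt_toReal (by positivity) hKfin).1 hKL
  have hk0 : 0 < k := lt_trans (by positivity) hkL
  set w : EuclideanSpace ℝ (Fin (n + 1)) → ℝ := fun x => μ x * v x ^ 2 with hw
  have hw0 : ∀ x, 0 ≤ w x := fun x => mul_nonneg (hμ0 x) (by positivity)
  have hwm : Measurable w := hμm.mul (hv.continuous.measurable.pow_const 2)
  have hwi : IntegrableOn w Ω := by
    obtain ⟨S, hS⟩ := (isCompact_closedBall (0 : EuclideanSpace ℝ (Fin (n + 1))) σ).exists_bound_of_continuousOn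
      (hv.continuous.pow 2).continuousOn
    have h1 : IntegrableOn (fun x => (1 + μ x ^ p) * S) Ω := by
      refine Integrable.mul_const (Integrable.add ?_ hμi) _
      exact integrableOn_const measure_ball_lt_top.ne
    refine Integrable.mono' h1 hwm.aestronglyMeasurable ?_
    filter_upwards [ae_restrict_mem measurableSet_ball] with x hx
    rw [Real.norm_of_nonneg (hw0 x)]
    have h2 : v x ^ 2 ≤ S := (le_abs_self _).trans (hS x (ball_subset_closedBall hx))
    have h3 : μ x ≤ 1 + μ x ^ p := by
      have hpn := Real.rpow_nonneg (hμ0 x) p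
      rcases le_total (μ x) 1 with h | h
      · linarith
      · have := Real.self_le_rpow_of_one_le h hp1.le
        linarith
    exact mul_le_mul h3 h2 (by positivity) ((hμ0 x).trans h3)
  have hwK : (∫⁻ x in {x | ‖x‖ ∈ K}, ENNReal.ofReal (w x)).toReal ≤ C * (T ^ (1 / γ) * k) := by
    refine ENNReal.toReal_le_of_le_ofReal (by positivity) ?_
    have e1 : ∀ x, ENNReal.ofReal (w x) = M x * ‖v x‖ₑ ^ (2 : ℝ) := by
      intro x
      rw [hw, hM]
      simp only
      rw [ENNReal.ofReal_mul (hμ0 x), ← sq_abs, ENNReal.ofReal_pow (abs_nonneg _), ← Real.norm_eq_abs,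
        ofReal_norm, ENNReal.rpow_ofNat]
    simp_rw [e1]
    refine (hFK K hKc.measurableSet hKI).trans ?_
    rw [ENNReal.ofReal_mul (by positivity), ENNReal.ofReal_coe_nnreal]
    gcongr
    calc ∫⁻ r in K, F r ^ (1 / γ) ≤ ∫⁻ r in K, ENNReal.ofReal (T ^ (1 / γ)) := by
          refine setLIntegral_mono' hKc.measurableSet fun r hr => ?_
          rw [← ENNReal.ofReal_rpow_of_nonneg hT0 (by positivity)]
          gcongr
          exact hKF' r hr
      _ = _ := by
          rw [setLIntegral_const, ENNReal.ofReal_mul (by positivity), hk, measureReal_def, ENNReal.ofReal_toReal hKfin]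
  have hmain : 4 / (σ - ρ) * (C * T ^ (1 / γ)) ≤
      (4 * C * (2 * C) ^ (1 / γ) * 2 ^ (2 / s) + 1) * (σ - ρ) ^ (-1 + -(1 / γ)) * A ^ (1 / p) *
        (G ^ (2 / s) + ρ ^ (-2 : ℝ) * V ^ (2 / s)) := by
    have hTe : T ^ (1 / γ) = (2 * C) ^ (1 / γ) * (σ - ρ) ^ (-(1 / γ)) * (A ^ (1 / p) * B ^ (2 / s)) := by
      have : T = (2 * C) * (σ - ρ)⁻¹ * (A ^ (γ * (1 / p)) * B ^ (γ * (2 / s))) := by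
        rw [hT, hX']; ring
      rw [this, Real.mul_rpow (by positivity) (by positivity), Real.mul_rpow (by positivity) (by positivity),
        Real.mul_rpow (x := A ^ (γ * (1 / p))) (y := B ^ (γ * (2 / s))) (by positivity) (by positivity),
        ← Real.rpow_mul hA0, ← Real.rpow_mul hB0,
        Real.inv_rpow hL.le, Real.rpow_neg hL.le]
      congr 3 <;> field_simp
    have hBe : B ^ (2 / s) ≤ 2 ^ (2 / s) * (G ^ (2 / s) + ρ ^ (-2 : ℝ) * V ^ (2 / s)) := by
      have h1 : (ρ ^ (-s) * V) ^ (2 / s) = ρ ^ (-2 : ℝ) * V ^ (2 / s) := by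
        rw [Real.mul_rpow (by positivity) hV0, ← Real.rpow_mul hρ.le]
        congr 2; field_simp
      rw [← h1, hB]
      have hy : 0 ≤ ρ ^ (-s) * V := by positivity
      generalize ρ ^ (-s) * V = Y at hy
      have h2 : G + Y ≤ 2 * max G Y := by
        linarith [le_max_left G Y, le_max_right G Y]
      calc (G + Y) ^ (2 / s) ≤ (2 * max G Y) ^ (2 / s) := by gcongr
        _ = 2 ^ (2 / s) * (max G Y) ^ (2 / s) := Real.mul_rpow (by norm_num) (le_max_of_le_left hG0)
        _ ≤ _ := by
          gcongr
          have := Real.rpow_nonneg hG0 (2 / s)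
          have := Real.rpow_nonneg hy (2 / s)
          rcases max_cases G Y with h | h <;> rw [h.1] <;> linarith
    set R := G ^ (2 / s) + ρ ^ (-2 : ℝ) * V ^ (2 / s) with hR
    have hR0 : 0 ≤ R := by positivity
    rw [hTe, Real.rpow_add hL, Real.rpow_neg_one]
    calc 4 / (σ - ρ) * (C * ((2 * C) ^ (1 / γ) * (σ - ρ) ^ (-(1 / γ)) * (A ^ (1 / p) * B ^ (2 / s))))
        ≤ 4 / (σ - ρ) * (C * ((2 * C) ^ (1 / γ) * (σ - ρ) ^ (-(1 / γ)) * (A ^ (1 / p) * (2 ^ (2 / s) * R)))) := by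
          gcongr
      _ = (4 * C * (2 * C) ^ (1 / γ) * 2 ^ (2 / s)) * ((σ - ρ)⁻¹ * (σ - ρ) ^ (-(1 / γ))) * A ^ (1 / p) * R := by
          ring
      _ ≤ _ := by
          gcongr
          linarith
  refine le_trans ?_ hmain
  refine le_of_forall_pos_le_add fun δ hδ => ?_
  obtain ⟨η, h1, h2, h3, h4, h5, h6⟩ := cutoff ρ σ hρ w hwm hw0 hwi K hKc hKI hk0 (δ * k ^ 2)
    (mul_pos hδ (pow_pos hk0 2))
  refine le_trans (b := ∫ x in Ω, w x * ‖gradient η x‖ ^ 2) (csInf_le ?_ ?_) (h6.trans ?_)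
  · refine ⟨0, ?_⟩
    rintro I ⟨η', -, -, -, -, -, rfl⟩
    exact integral_nonneg fun x => mul_nonneg (hw0 x) (by positivity)
  · exact ⟨η, h1, h2, h3, h4, h5, rfl⟩
  · calc k⁻¹ ^ 2 * ((∫⁻ x in {x | ‖x‖ ∈ K}, ENNReal.ofReal (w x)).toReal + δ * k ^ 2)
        ≤ k⁻¹ ^ 2 * (C * (T ^ (1 / γ) * k) + δ * k ^ 2) := by gcongr
      _ = k⁻¹ * (C * T ^ (1 / γ)) + δ := by field_simp
      _ ≤ _ := by
        have hk4 : k⁻¹ ≤ 4 / (σ - ρ) := by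
          rw [inv_le_comm₀ hk0 (by positivity), inv_div]
          exact hkL.le
        gcongr
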